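/- arXiv:2101.09225 — 4 statements merged into one kernel-verified Lean document; each statement's English description precedes it below -/
import Mathlib

section
/- Let X and Y be Polish spaces, let μ be a Borel probability measure on X and ν a Borel probability measure on Y, and let c : X × Y → [0, ∞] be lower semicontinuous. Then the Kantorovich problem admits a minimizer: there exists a coupling γ* ∈ Π(μ, ν) such that ∫_{X×Y} c(x,y) dγ*(x,y) = inf_{γ ∈ Π(μ,ν)} ∫_{X×Y} c(x,y) dγ(x,y). -/
open MeasureTheory ENNReal

noncomputable section

/-- The set of couplings of `μ` and `ν`. -/
def Coupling {X Y : Type*} [MeasurableSpace X] [MeasurableSpace Y]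
    (μ : Measure X) (ν : Measure Y) : Set (Measure (X × Y)) :=
  {γ | γ.map Prod.fst = μ ∧ γ.map Prod.snd = ν}

/-- Layer cake formula for extended nonnegative functions, without a finiteness assumption. -/
lemma lintegral_eq_lintegral_meas_ofReal_lt {Ω : Type*} [MeasurableSpace Ω]
    (μ : Measure Ω) [SFinite μ] {f : Ω → ℝ≥0∞} (hf : Measurable f) :
    ∫⁻ ω, f ω ∂μ = ∫⁻ t in Set.Ioi (0 : ℝ), μ {ω | ENNReal.ofReal t < f ω} := by
  have hmeas : MeasurableSet {z : Ω × ℝ | ENNReal.ofReal z.2 < f z.1} :=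
    measurableSet_lt (ENNReal.measurable_ofReal.comp measurable_snd) (hf.comp measurable_fst)
  have hfiber (a : ℝ≥0∞) :
      (volume.restrict (Set.Ioi (0 : ℝ))) {t | ENNReal.ofReal t < a} = a := by
    rw [Measure.restrict_apply (measurableSet_lt ENNReal.measurable_ofReal measurable_const)]
    obtain rfl | ha := eq_or_ne a ∞
    · simp
    · have : {t | ENNReal.ofReal t < a} ∩ Set.Ioi (0 : ℝ) = Set.Ioo 0 a.toReal := by
        ext t
        simp only [Set.mem_inter_iff, Set.mem_ofPred_eq, Set.mem_Ioi, Set.mem_Ioo]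
        rw [and_comm]
        exact and_congr_right fun ht => ENNReal.ofReal_lt_iff_lt_toReal ht.le ha
      rw [this, Real.volume_Ioo, sub_zero, ENNReal.ofReal_toReal ha]
  calc ∫⁻ ω, f ω ∂μ
      = (μ.prod (volume.restrict (Set.Ioi (0 : ℝ)))) {z | ENNReal.ofReal z.2 < f z.1} := by
        rw [Measure.prod_apply hmeas]
        exact lintegral_congr fun ω => (hfiber (f ω)).symm
    _ = ∫⁻ t in Set.Ioi (0 : ℝ), μ {ω | ENNReal.ofReal t < f ω} :=
        Measure.prod_apply_symm hmeas

/-- Integrating a nonnegative lower semicontinuous function is lower semicontinuous for weak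
convergence of probability measures. -/
lemma LowerSemicontinuous.lintegral_probabilityMeasure {Ω : Type*} [TopologicalSpace Ω]
    [TopologicalSpace.PseudoMetrizableSpace Ω] [TopologicalSpace.SeparableSpace Ω]
    [MeasurableSpace Ω] [BorelSpace Ω] {f : Ω → ℝ≥0∞} (hf : LowerSemicontinuous f) :
    LowerSemicontinuous fun γ : ProbabilityMeasure Ω => ∫⁻ ω, f ω ∂(γ : Measure Ω) := by
  refine fun γ => lowerSemicontinuousAt_iff_le_liminf.2 ?_
  simp_rw [lintegral_eq_lintegral_meas_ofReal_lt _ hf.measurable]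
  have hanti (γ' : ProbabilityMeasure Ω) :
      Antitone fun t : ℝ => (γ' : Measure Ω) {ω | ENNReal.ofReal t < f ω} :=
    fun _ _ hst => measure_mono fun _ hω => (ENNReal.ofReal_le_ofReal hst).trans_lt hω
  refine (lintegral_mono fun t => ?_).trans (lintegral_liminf_le fun γ' => (hanti γ').measurable)
  exact ProbabilityMeasure.le_liminf_measure_open_of_tendsto Filter.tendsto_id
    (hf.isOpen_preimage _)

/-- The set of couplings of two tight measures is tight. -/
lemma isTightMeasureSet_coupling {X Y : Type*} [TopologicalSpace X] [MeasurableSpace X]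
    [OpensMeasurableSpace X] [T2Space X] [TopologicalSpace Y] [MeasurableSpace Y]
    [OpensMeasurableSpace Y] [T2Space Y] {μ : Measure X} {ν : Measure Y}
    (hμ : IsTightMeasureSet {μ}) (hν : IsTightMeasureSet {ν}) :
    IsTightMeasureSet (Coupling μ ν) := by
  rw [isTightMeasureSet_iff_exists_isCompact_measure_compl_le] at *
  intro ε hε
  obtain ⟨K, hK, hKμ⟩ := hμ (ε / 2) (ENNReal.half_pos hε.ne')
  obtain ⟨L, hL, hLν⟩ := hν (ε / 2) (ENNReal.half_pos hε.ne')
  refine ⟨K ×ˢ L, hK.prod hL, ?_⟩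
  rintro γ ⟨hfst, hsnd⟩
  calc γ (K ×ˢ L)ᶜ ≤ γ (Prod.fst ⁻¹' Kᶜ ∪ Prod.snd ⁻¹' Lᶜ) := by
        refine measure_mono fun p hp => ?_
        by_contra h
        simp_all
    _ ≤ γ (Prod.fst ⁻¹' Kᶜ) + γ (Prod.snd ⁻¹' Lᶜ) := measure_union_le _ _
    _ = μ Kᶜ + ν Lᶜ := by
        rw [← Measure.map_apply measurable_fst hK.measurableSet.compl, hfst,
          ← Measure.map_apply measurable_snd hL.measurableSet.compl, hsnd]
    _ ≤ ε / 2 + ε / 2 := add_le_add (hKμ μ rfl) (hLν ν rfl)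
    _ = ε := ENNReal.add_halves ε

/-- The couplings of two Borel probability measures on Polish spaces form a weakly compact set. -/
lemma isCompact_setOf_coupling {X Y : Type*} [TopologicalSpace X] [PolishSpace X]
    [MeasurableSpace X] [BorelSpace X] [TopologicalSpace Y] [PolishSpace Y] [MeasurableSpace Y]
    [BorelSpace Y] (μ : ProbabilityMeasure X) (ν : ProbabilityMeasure Y) :
    IsCompact {γ : ProbabilityMeasure (X × Y) | (γ : Measure (X × Y)) ∈ Coupling μ ν} := by
  have hclosed :
      IsClosed {γ : ProbabilityMeasure (X × Y) | (γ : Measure (X × Y)) ∈ Coupling μ ν} := by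
    convert (isClosed_singleton (x := μ)).preimage
      (ProbabilityMeasure.continuous_map (continuous_fst : Continuous (Prod.fst : X × Y → X)))
      |>.inter ((isClosed_singleton (x := ν)).preimage
        (ProbabilityMeasure.continuous_map (continuous_snd : Continuous (Prod.snd : X × Y → Y))))
      using 1
    ext γ
    exact ⟨fun h => ⟨Subtype.ext h.1, Subtype.ext h.2⟩,
      fun h => ⟨congrArg Subtype.val h.1, congrArg Subtype.val h.2⟩⟩
  rw [← hclosed.closure_eq]
  refine isCompact_closure_of_isTightMeasureSet ?_
  refine (isTightMeasureSet_coupling (isTightMeasureSet_singleton (μ := (μ : Measure X)))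
    (isTightMeasureSet_singleton (μ := (ν : Measure Y)))).subset ?_
  rintro _ ⟨γ, hγ, rfl⟩
  exact hγ

/-- **Existence of an optimal transport plan.** For Polish spaces `X`, `Y`, Borel
probability measures `μ`, `ν`, and a lower semicontinuous cost `c : X × Y → [0, ∞]`,
the Kantorovich problem admits a minimizer. -/
theorem kantorovich_exists_minimizer
    {X Y : Type*} [TopologicalSpace X] [PolishSpace X] [MeasurableSpace X] [BorelSpace X]
    [TopologicalSpace Y] [PolishSpace Y] [MeasurableSpace Y] [BorelSpace Y]
    (μ : Measure X) (ν : Measure Y) [IsProbabilityMeasure μ] [IsProbabilityMeasure ν]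
    (c : X × Y → ℝ≥0∞) (hc : LowerSemicontinuous c) :
    ∃ γ ∈ Coupling μ ν, ∫⁻ p, c p ∂γ = ⨅ γ' ∈ Coupling μ ν, ∫⁻ p, c p ∂γ' := by
  have hprod : μ.prod ν ∈ Coupling μ ν := by
    simp [Coupling]
  obtain ⟨γ, hγ, hmin⟩ := (hc.lintegral_probabilityMeasure.lowerSemicontinuousOn _).exists_isMinOn
    ⟨⟨_, inferInstance⟩, hprod⟩ (isCompact_setOf_coupling ⟨μ, ‹_›⟩ ⟨ν, ‹_›⟩)
  refine ⟨γ, hγ, le_antisymm (le_iInf₂ fun γ' hγ' => ?_) (iInf₂_le (γ : Measure (X × Y)) hγ)⟩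
  have : IsProbabilityMeasure γ' := by
    have : IsProbabilityMeasure (γ'.map Prod.fst) := by rwa [hγ'.1]
    exact Measure.isProbabilityMeasure_of_map Prod.fst
  exact hmin (a := ⟨γ', this⟩) hγ'
end
end

section
/- Let X and Y be Polish spaces, let μ be a Borel probability measure on X with no atoms, let ν be a Borel probability measure on Y, and let c : X × Y → [0, ∞) be continuous and real-valued. Then the infimum of the Monge problem equals the infimum of the Kantorovich problem: inf { ∫_X c(x, T(x)) dμ(x) : T : X → Y Borel measurable with T♯μ = ν } = inf { ∫_{X×Y} c(x,y) dγ(x,y) : γ ∈ Π(μ, ν) }. -/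
open MeasureTheory ENNReal

noncomputable section

section AtomlessTransport

open Filter Topology ProbabilityTheory Set unitInterval

theorem continuous_cdf (Q : Measure ℝ) [IsProbabilityMeasure Q] [NullSingletonClass Q] :
    Continuous (cdf Q) := by
  rw [continuous_iff_continuousAt]
  intro x
  rw [(monotone_cdf Q).continuousAt_iff_leftLim_eq_rightLim, (cdf Q).rightLim_eq]
  refine le_antisymm ((monotone_cdf Q).leftLim_le le_rfl) ?_
  have h : (cdf Q).measure {x} = 0 := by rw [measure_cdf]; exact measure_singleton x
  rw [StieltjesFunction.measure_singleton, ENNReal.ofReal_eq_zero] at h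
  linarith

/-- The distribution function of an atomless law on the line is uniformly distributed. -/
theorem measure_cdf_le (Q : Measure ℝ) [IsProbabilityMeasure Q] [NullSingletonClass Q] (t : I) :
    Q {x | cdf Q x ≤ t} = ENNReal.ofReal t := by
  have hc := continuous_cdf Q
  rcases eq_or_lt_of_le t.2.2 with h1 | h1
  · simp [h1, cdf_le_one]
  obtain ⟨y, hy⟩ := ((tendsto_cdf_atTop Q).eventually_const_lt h1).exists
  rcases Set.eq_empty_or_nonempty {x | cdf Q x ≤ t} with he | hne
  · rw [he, measure_empty, eq_comm, ENNReal.ofReal_eq_zero]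
    by_contra! h0
    obtain ⟨x, hx⟩ := ((tendsto_cdf_atBot Q).eventually_lt_const h0).exists
    exact Set.notMem_empty x (he ▸ hx.le)
  · have hbdd : BddAbove {x | cdf Q x ≤ t} :=
      ⟨y, fun x hx => le_of_not_gt fun h => (hy.trans_le (monotone_cdf Q h.le)).not_ge hx⟩
    have hcl : IsClosed {x | cdf Q x ≤ t} := isClosed_le hc continuous_const
    set z := sSup {x | cdf Q x ≤ t}
    have hz : cdf Q z ≤ t := hcl.csSup_mem hne hbdd
    have hzy : z ≤ y := le_of_not_gt fun h => (hy.trans_le (monotone_cdf Q h.le)).not_ge hz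
    obtain ⟨w, -, hw⟩ := intermediate_value_Icc hzy hc.continuousOn ⟨hz, hy.le⟩
    have hwz : w ≤ z := le_csSup hbdd hw.le
    have hS : {x | cdf Q x ≤ t} = Iic z :=
      Set.Subset.antisymm (fun x hx => le_csSup hbdd hx)
        fun x hx => (monotone_cdf Q hx).trans hz
    rw [hS, ← ofReal_cdf, ← hw, le_antisymm hz (hw ▸ monotone_cdf Q hwz), hw]

theorem exists_measurable_map_eq_volume {X : Type*} [MeasurableSpace X] [StandardBorelSpace X]
    (P : Measure X) [IsProbabilityMeasure P] [NullSingletonClass P] :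
    ∃ u : X → I, Measurable u ∧ P.map u = volume := by
  have he := measurableEmbedding_embeddingReal X
  set Q := P.map (embeddingReal X)
  have : IsProbabilityMeasure Q := Measure.isProbabilityMeasure_map he.measurable.aemeasurable
  have : NullSingletonClass Q := ⟨fun x => by
    rw [he.map_apply]
    exact (subsingleton_singleton.preimage he.injective).measure_zero P⟩
  have hu : Measurable fun x : X =>
      (⟨cdf Q (embeddingReal X x), cdf_nonneg _ _, cdf_le_one _ _⟩ : I) :=
    ((continuous_cdf Q).measurable.comp he.measurable).subtype_mk
  refine ⟨_, hu, ?_⟩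
  have := Measure.isProbabilityMeasure_map (μ := P) hu.aemeasurable
  refine Measure.ext_of_Iic _ _ fun t => ?_
  rw [Measure.map_apply hu measurableSet_Iic, unitInterval.volume_Iic, ← measure_cdf_le Q t,
    he.map_apply]
  rfl

theorem exists_measurable_map_eq_of_measure_univ_eq {X Y : Type*}
    [MeasurableSpace X] [StandardBorelSpace X] [MeasurableSpace Y] [StandardBorelSpace Y]
    [Nonempty Y] (ρ : Measure X) [IsFiniteMeasure ρ] [NullSingletonClass ρ] (ν : Measure Y)
    (h : ρ univ = ν univ) : ∃ T : X → Y, Measurable T ∧ ρ.map T = ν := by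
  rcases eq_or_ne (ρ univ) 0 with h0 | h0
  · inhabit Y
    refine ⟨fun _ => default, measurable_const, ?_⟩
    rw [(Measure.measure_univ_eq_zero (μ := ρ)).1 h0, (Measure.measure_univ_eq_zero (μ := ν)).1 (h ▸ h0),
      Measure.map_zero]
  have : IsProbabilityMeasure ((ρ univ)⁻¹ • ρ) := ⟨by
    simp [ENNReal.inv_mul_cancel h0 (measure_ne_top _ _)]⟩
  have : IsProbabilityMeasure ((ρ univ)⁻¹ • ν) := ⟨by
    simp [← h, ENNReal.inv_mul_cancel h0 (measure_ne_top _ _)]⟩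
  have : NullSingletonClass ((ρ univ)⁻¹ • ρ) := ⟨fun x => by simp⟩
  obtain ⟨u, hu, hum⟩ := exists_measurable_map_eq_volume ((ρ univ)⁻¹ • ρ)
  obtain ⟨f, hf, hfm⟩ := ((ρ univ)⁻¹ • ν).exists_measurable_map_eq
  refine ⟨f ∘ u, hf.comp hu, ?_⟩
  rw [← hum, Measure.map_map hf hu, Measure.map_smul] at hfm
  have := congrArg (ρ univ • ·) hfm
  simpa [smul_smul, ENNReal.mul_inv_cancel h0 (measure_ne_top _ _)] using this

/-- A measure dominated by an atomless probability takes every intermediate value between nested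
sets. -/
theorem exists_measurableSet_between {X : Type*} [MeasurableSpace X] [StandardBorelSpace X]
    (P : Measure X) [IsProbabilityMeasure P] [NullSingletonClass P] {τ : Measure X} (hτ : τ ≤ P)
    {B A : Set X} (hB : MeasurableSet B) (hA : MeasurableSet A) (hBA : B ⊆ A) {r : ℝ≥0∞}
    (hBr : τ B ≤ r) (hrA : r ≤ τ A) :
    ∃ C, MeasurableSet C ∧ B ⊆ C ∧ C ⊆ A ∧ τ C = r := by
  obtain ⟨u, hu, hum⟩ := exists_measurable_map_eq_volume P
  have : IsFiniteMeasure τ := isFiniteMeasure_of_le P hτ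
  set D : I → Set X := fun t => B ∪ A ∩ u ⁻¹' Iic t
  have hD t : MeasurableSet (D t) := hB.union (hA.inter (hu measurableSet_Iic))
  have hmono : Monotone D := fun s t hst =>
    union_subset_union_right _ (inter_subset_inter_right _ (preimage_mono (Iic_subset_Iic.2 hst)))
  have hinc {s t : I} (hst : s ≤ t) : τ.real (D t) ≤ τ.real (D s) + (t - s) := by
    have hsub : D t ⊆ D s ∪ u ⁻¹' Ioc s t := by
      rintro x (hx | ⟨hx, hxt⟩)
      · exact .inl (.inl hx)
      · by_cases hxs : u x ≤ s
        · exact .inl (.inr ⟨hx, hxs⟩)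
        · exact .inr ⟨not_le.1 hxs, hxt⟩
    have hs : τ.real (u ⁻¹' Ioc s t) ≤ t - s := by
      refine ENNReal.toReal_le_of_le_ofReal (sub_nonneg.2 hst) ((hτ _).trans_eq ?_)
      rw [← unitInterval.volume_Ioc, ← hum, Measure.map_apply hu measurableSet_Ioc]
    exact (measureReal_mono hsub).trans ((measureReal_union_le _ _).trans (by gcongr))
  have hcont : Continuous fun t => τ.real (D t) := by
    refine (LipschitzWith.of_le_add fun s t => ?_).continuous
    rcases le_total s t with h | h
    · exact (measureReal_mono (hmono h)).trans (le_add_of_nonneg_right dist_nonneg)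
    · rw [Subtype.dist_eq, Real.dist_eq, abs_of_nonneg (sub_nonneg.2 (show (t : ℝ) ≤ s from h))]
      exact hinc h
  have h0 : τ (D 0) = τ B := by
    refine le_antisymm ((measure_union_le _ _).trans ?_) (measure_mono subset_union_left)
    have : τ (A ∩ u ⁻¹' Iic 0) = 0 := by
      refine le_antisymm (((measure_mono inter_subset_right).trans (hτ _)).trans_eq ?_) zero_le
      rw [← Measure.map_apply hu measurableSet_Iic, hum, unitInterval.volume_Iic]
      simp
    rw [this, add_zero]
  have h1 : D 1 = A := by
    refine Set.Subset.antisymm (union_subset hBA inter_subset_left) fun x hx => .inr ⟨hx, ?_⟩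
    exact le_one'
  have hr : r ≠ ∞ := ne_top_of_le_ne_top (measure_ne_top _ _) hrA
  obtain ⟨t, -, ht⟩ := intermediate_value_Icc (zero_le_one' I) hcont.continuousOn
    (show r.toReal ∈ Icc _ _ from
      ⟨by rw [measureReal_def, h0]; exact ENNReal.toReal_mono hr hBr,
       by rw [h1]; exact ENNReal.toReal_mono (measure_ne_top _ _) hrA⟩)
  exact ⟨D t, hD t, subset_union_left, union_subset hBA inter_subset_left,
    (ENNReal.toReal_eq_toReal_iff' (measure_ne_top _ _) hr).1 ht⟩

/-- Pairwise disjoint sets `E i ⊆ A i` that carry, for a measure `τ`, all of the mass of `τ`. -/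
structure IsDisjointSelection {X : Type*} [MeasurableSpace X] (A : ℕ → Set X) (k : ℕ)
    (τ : Measure X) (E : ℕ → Set X) : Prop where
  measurableSet : ∀ i, MeasurableSet (E i)
  subset : ∀ i, E i ⊆ A i
  disjoint : Pairwise (Function.onFun Disjoint E)
  eq_empty : ∀ i, k ≤ i → E i = ∅
  compl_null : τ (⋃ i, E i)ᶜ = 0

theorem IsDisjointSelection.exists_succ {X : Type*} [MeasurableSpace X] [StandardBorelSpace X]
    {P : Measure X} [IsProbabilityMeasure P] [NullSingletonClass P] {A : ℕ → Set X}
    (hA : ∀ i, MeasurableSet (A i)) {k : ℕ} {τ m : Measure X} (hle : τ + m ≤ P)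
    (hm : m (A k)ᶜ = 0) {E : ℕ → Set X} (hE : IsDisjointSelection A k τ E) :
    ∃ E', IsDisjointSelection A (k + 1) (τ + m) E' ∧
      (∀ i ≠ k, E' i ⊆ E i ∧ (τ + m) (E' i) = τ (E i)) ∧ (τ + m) (E' k) = m univ := by
  have hfin : IsFiniteMeasure (τ + m) := isFiniteMeasure_of_le P hle
  have hfinτ : IsFiniteMeasure τ := isFiniteMeasure_of_le (τ + m) (Measure.le_add_right le_rfl)
  have hC i : ∃ C, MeasurableSet C ∧ E i \ A k ⊆ C ∧ C ⊆ E i ∧ (τ + m) C = τ (E i) := by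
    refine exists_measurableSet_between P hle ((hE.measurableSet i).diff (hA k))
      (hE.measurableSet i) sdiff_subset ?_ ?_
    · rw [Measure.add_apply, measure_mono_null (fun x hx => hx.2) hm, add_zero]
      exact measure_mono sdiff_subset
    · rw [Measure.add_apply]
      exact le_self_add
  choose C hCm hBC hCE hCτ using hC
  have hCk : C k = ∅ := subset_empty_iff.1 (hE.eq_empty k le_rfl ▸ hCE k)
  have hCd : Pairwise (Function.onFun Disjoint C) := fun i j hij =>
    (hE.disjoint hij).mono (hCE i) (hCE j)
  set U := ⋃ i, C i
  have hUm : MeasurableSet U := .iUnion hCm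
  have hU : (τ + m) U = τ univ := by
    rw [measure_iUnion hCd hCm]
    simp_rw [hCτ]
    rw [← measure_iUnion hE.disjoint hE.measurableSet,
      ← measure_add_measure_compl (μ := τ) (MeasurableSet.iUnion hE.measurableSet), hE.compl_null,
      add_zero]
  have hUc : (τ + m) Uᶜ = m univ := by
    have h := measure_add_measure_compl (μ := τ + m) hUm
    rw [hU, Measure.add_apply τ m univ] at h
    exact (ENNReal.add_right_inj (measure_ne_top _ _)).1 h
  have hnull : (τ + m) (Uᶜ \ A k) = 0 := by
    rw [Measure.add_apply, measure_mono_null (fun x hx => hx.2) hm, add_zero]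
    refine measure_mono_null (show _ ⊆ (⋃ i, E i)ᶜ from fun x hx hxE => ?_) hE.compl_null
    obtain ⟨i, hi⟩ := mem_iUnion.1 hxE
    exact hx.1 (mem_iUnion.2 ⟨i, hBC i ⟨hi, hx.2⟩⟩)
  have hsub {i} : C i ⊆ U := subset_iUnion C i
  have hne {i} (hi : i ≠ k) : Function.update C k (A k \ U) i = C i := Function.update_of_ne hi _ _
  have heq : Function.update C k (A k \ U) k = A k \ U := Function.update_self ..
  have hUE : U ⊆ ⋃ i, Function.update C k (A k \ U) i := by
    refine iUnion_subset fun i => ?_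
    rcases eq_or_ne i k with rfl | hi
    · simp [hCk]
    · exact hne hi ▸ subset_iUnion (Function.update C k (A k \ U)) i
  refine ⟨Function.update C k (A k \ U),
    ⟨fun i => ?_, fun i => ?_, fun i j hij => ?_, fun i hi => ?_, ?_⟩, fun i hi => ?_, ?_⟩
  · rcases eq_or_ne i k with rfl | hi
    · rw [heq]; exact (hA i).diff hUm
    · rw [hne hi]; exact hCm i
  · rcases eq_or_ne i k with rfl | hi
    · rw [heq]; exact sdiff_subset
    · rw [hne hi]; exact (hCE i).trans (hE.subset i)
  · rw [Function.onFun]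
    rcases eq_or_ne i k with rfl | hi
    · rw [heq, hne hij.symm]
      exact disjoint_sdiff_left.mono_right hsub
    · rcases eq_or_ne j k with rfl | hj
      · rw [heq, hne hi]
        exact disjoint_sdiff_right.mono_left hsub
      · rw [hne hi, hne hj]
        exact hCd hij
  · rw [hne (by omega)]
    exact subset_empty_iff.1 (hE.eq_empty i (by omega) ▸ hCE i)
  · refine measure_mono_null (show _ ⊆ Uᶜ \ A k from
      fun x hx => ⟨fun hxU => hx (hUE hxU), fun hxA => hx ?_⟩) hnull
    by_cases hxU : x ∈ U
    · exact hUE hxU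
    · exact mem_iUnion.2 ⟨k, by rw [heq]; exact ⟨hxA, hxU⟩⟩
  · rw [hne hi]
    exact ⟨hCE i, hCτ i⟩
  · rw [heq, ← hUc, ← measure_inter_add_sdiff Uᶜ (hA k), hnull, add_zero, Set.sdiff_eq, inter_comm]

/-- If an atomless probability measure is a countable sum of measures `m i` concentrated on `A i`,
then it has disjoint sets `S i ⊆ A i` of the same masses as the `m i`. -/
theorem exists_disjoint_subsets_measure_eq {X : Type*} [MeasurableSpace X] [StandardBorelSpace X]
    {P : Measure X} [IsProbabilityMeasure P] [NullSingletonClass P] {A : ℕ → Set X}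
    (hA : ∀ i, MeasurableSet (A i)) {m : ℕ → Measure X} (hsum : Measure.sum m = P)
    (hm : ∀ i, m i (A i)ᶜ = 0) :
    ∃ S : ℕ → Set X, (∀ i, MeasurableSet (S i)) ∧ (∀ i, S i ⊆ A i) ∧
      Pairwise (Function.onFun Disjoint S) ∧ ∀ i, P (S i) = m i univ := by
  set τ : ℕ → Measure X := fun k => ∑ i ∈ Finset.range k, m i
  have hτs k : τ (k + 1) = τ k + m k := Finset.sum_range_succ m k
  have hτ k : τ k ≤ P := by
    refine Measure.le_intro fun s hs _ => ?_
    rw [← hsum, Measure.sum_apply _ hs, Measure.finsetSum_apply]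
    exact ENNReal.sum_le_tsum _
  have hstep (k : ℕ) (E : {E // IsDisjointSelection A k (τ k) E}) :
      ∃ E' : {E // IsDisjointSelection A (k + 1) (τ (k + 1)) E},
        (∀ i ≠ k, E'.1 i ⊆ E.1 i ∧ τ (k + 1) (E'.1 i) = τ k (E.1 i)) ∧
          τ (k + 1) (E'.1 k) = m k univ := by
    obtain ⟨E', h, h'⟩ := E.2.exists_succ hA (hτs k ▸ hτ (k + 1)) (hm k)
    rw [← hτs k] at h h'
    exact ⟨⟨E', h⟩, h'⟩
  choose step hne heq using hstep
  let seq : (k : ℕ) → {E // IsDisjointSelection A k (τ k) E} := Nat.rec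
    ⟨fun _ => ∅, by constructor <;> simp [τ, Pairwise, Function.onFun]⟩ step
  have hmass i j : τ (i + 1 + j) ((seq (i + 1 + j)).1 i) = m i univ := by
    induction j with
    | zero => exact heq i (seq i)
    | succ j ih => exact (hne (i + 1 + j) (seq _) i (by omega)).2.trans ih
  have hanti i : Antitone fun j => (seq (i + 1 + j)).1 i :=
    antitone_nat_of_succ_le fun j => (hne (i + 1 + j) (seq _) i (by omega)).1
  set S : ℕ → Set X := fun i => ⋂ j, (seq (i + 1 + j)).1 i
  have hSsub i j : S i ⊆ (seq (i + 1 + j)).1 i := iInter_subset _ j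
  have hSm i : MeasurableSet (S i) := .iInter fun j => (seq (i + 1 + j)).2.measurableSet i
  have hSd : Pairwise (Function.onFun Disjoint S) := fun i j hij => by
    refine ((seq (i + 1 + j)).2.disjoint hij).mono (hSsub i j) ?_
    rw [show i + 1 + j = j + 1 + i by omega]
    exact hSsub j i
  have hge i : m i univ ≤ P (S i) := by
    rw [(hanti i).measure_iInter
      (fun j => ((seq (i + 1 + j)).2.measurableSet i).nullMeasurableSet) ⟨0, measure_ne_top _ _⟩]
    exact le_iInf fun j => hmass i j ▸ hτ _ _
  have htot : ∑' i, P (S i) ≤ ∑' i, m i univ := by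
    rw [← measure_iUnion hSd hSm, ← Measure.sum_apply m .univ, hsum]
    exact measure_mono (subset_univ _)
  refine ⟨S, hSm, fun i => (hSsub i 0).trans ((seq (i + 1 + 0)).2.subset i), hSd, fun i => ?_⟩
  by_contra hi
  refine (ENNReal.tsum_lt_tsum ?_ hge ((hge i).lt_of_ne' hi)).not_ge htot
  rw [← Measure.sum_apply m .univ, hsum]
  exact measure_ne_top _ _

theorem exists_rectangles_cover {X Y : Type*} [TopologicalSpace X] [SecondCountableTopology X]
    [TopologicalSpace Y] [SecondCountableTopology Y] [Nonempty (X × Y)] {c : X × Y → ℝ}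
    (hc : Continuous c) {ε : ℝ} (hε : 0 < ε) :
    ∃ (A : ℕ → Set X) (B : ℕ → Set Y), (∀ i, IsOpen (A i)) ∧ (∀ i, IsOpen (B i)) ∧
      (⋃ i, A i ×ˢ B i) = univ ∧
      ∀ i, ∀ p ∈ A i ×ˢ B i, ∀ q ∈ A i ×ˢ B i, c p ≤ c q + ε := by
  have hX := TopologicalSpace.isBasis_countableBasis X
  have hY := TopologicalSpace.isBasis_countableBasis Y
  set R : Set (Set X × Set Y) :=
    {W | W ∈ TopologicalSpace.countableBasis X ×ˢ TopologicalSpace.countableBasis Y ∧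
      ∀ p ∈ W.1 ×ˢ W.2, ∀ q ∈ W.1 ×ˢ W.2, c p ≤ c q + ε}
  have hcov (p : X × Y) : ∃ W ∈ R, p ∈ W.1 ×ˢ W.2 := by
    obtain ⟨V, hV, hpV, hVs⟩ := (hX.prod hY).mem_nhds_iff.1
      (hc.continuousAt.preimage_mem_nhds (Metric.ball_mem_nhds (c p) (half_pos hε)))
    obtain ⟨A, hA, B, hB, rfl⟩ := hV
    refine ⟨(A, B), ⟨⟨hA, hB⟩, fun q hq r hr => ?_⟩, hpV⟩
    have h1 := abs_lt.1 (Real.dist_eq _ _ ▸ Metric.mem_ball.1 (hVs hq))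
    have h2 := abs_lt.1 (Real.dist_eq _ _ ▸ Metric.mem_ball.1 (hVs hr))
    linarith [h1.2, h2.1]
  have hR : R.Countable :=
    ((TopologicalSpace.countable_countableBasis X).prod
      (TopologicalSpace.countable_countableBasis Y)).mono fun W hW => hW.1
  have hne : R.Nonempty := let ⟨W, hW, _⟩ := hcov (Classical.arbitrary _); ⟨W, hW⟩
  obtain ⟨f, hf⟩ := hR.exists_eq_range hne
  have hfR i : f i ∈ R := hf ▸ mem_range_self i
  refine ⟨fun i => (f i).1, fun i => (f i).2, fun i => hX.isOpen (hfR i).1.1,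
    fun i => hY.isOpen (hfR i).1.2, eq_univ_of_forall fun p => ?_, fun i => (hfR i).2⟩
  obtain ⟨W, hW, hp⟩ := hcov p
  obtain ⟨i, rfl⟩ := hf ▸ hW
  exact mem_iUnion.2 ⟨i, hp⟩

/-- Every coupling is nearly matched in cost by a transport map. -/
theorem exists_map_lintegral_le {X Y : Type*} [TopologicalSpace X] [PolishSpace X]
    [MeasurableSpace X] [BorelSpace X] [TopologicalSpace Y] [PolishSpace Y] [MeasurableSpace Y]
    [BorelSpace Y] (γ : Measure (X × Y)) [IsProbabilityMeasure γ]
    [NullSingletonClass (γ.map Prod.fst)] {c : X × Y → ℝ} (hc : Continuous c)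
    (hc0 : ∀ p, 0 ≤ c p) {ε : ℝ} (hε : 0 < ε) :
    ∃ T : X → Y, Measurable T ∧ (γ.map Prod.fst).map T = γ.map Prod.snd ∧
      ∫⁻ x, ENNReal.ofReal (c (x, T x)) ∂γ.map Prod.fst ≤
        ∫⁻ p, ENNReal.ofReal (c p) ∂γ + ENNReal.ofReal ε := by
  have : Nonempty (X × Y) := nonempty_of_isProbabilityMeasure γ
  have : Nonempty Y := this.map Prod.snd
  obtain ⟨A, B, hA, hB, hcov, hosc⟩ := exists_rectangles_cover hc hε
  have hAm i := (hA i).measurableSet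
  have hBm i := (hB i).measurableSet
  set μ := γ.map Prod.fst
  have : IsProbabilityMeasure μ := Measure.isProbabilityMeasure_map measurable_fst.aemeasurable
  set D := disjointed fun i => A i ×ˢ B i
  have hD i : D i ⊆ A i ×ˢ B i := disjointed_subset _ i
  have hDm i : MeasurableSet (D i) := .disjointed (fun i => (hAm i).prod (hBm i)) i
  have hDd : Pairwise (Function.onFun Disjoint D) := disjoint_disjointed _
  have hDU : ⋃ i, D i = univ := (iUnion_disjointed).trans hcov
  have hγ : Measure.sum (fun i => γ.restrict (D i)) = γ := by
    rw [← Measure.restrict_iUnion hDd hDm, hDU, Measure.restrict_univ]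
  obtain ⟨S, hSm, hSA, hSd, hSμ⟩ := exists_disjoint_subsets_measure_eq (P := μ) hAm
    (m := fun i => (γ.restrict (D i)).map Prod.fst)
    (by rw [← Measure.map_sum measurable_fst.aemeasurable, hγ]) fun i => by
      rw [Measure.map_apply measurable_fst (hAm i).compl, Measure.restrict_apply' (hDm i)]
      exact measure_mono_null (fun x hx => (hx.1 (hD i hx.2).1).elim) measure_empty
  have hSμ i : μ (S i) = γ (D i) := by
    simp [hSμ i, Measure.map_apply measurable_fst]
  have hSae : ∀ᵐ x ∂μ, x ∈ ⋃ i, S i := by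
    refine (mem_ae_iff_prob_eq_one (.iUnion hSm)).2 ?_
    rw [measure_iUnion hSd hSm]
    simp_rw [hSμ]
    rw [← measure_iUnion hDd hDm, hDU, measure_univ]
  have hμ : Measure.sum (fun i => μ.restrict (S i)) = μ := by
    rw [← Measure.restrict_iUnion hSd hSm, Measure.restrict_eq_self_of_ae_mem hSae]
  have hT i : ∃ T : X → Y, Measurable T ∧
      (μ.restrict (S i)).map T = (γ.restrict (D i)).map Prod.snd :=
    exists_measurable_map_eq_of_measure_univ_eq _ _ <| by
      simp [hSμ i, Measure.map_apply measurable_snd]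
  choose T hTm hTmap using hT
  obtain ⟨f, hf, hfT⟩ := exists_measurable_piecewise S hSm T hTm fun i j hij x hx =>
    ((hSd hij).le_bot hx).elim
  have hfmap i : (μ.restrict (S i)).map f = (γ.restrict (D i)).map Prod.snd := by
    rw [← hTmap i]
    exact Measure.map_congr ((ae_restrict_iff' (hSm i)).2 (.of_forall fun x hx => hfT i hx))
  have hfB i : ∀ᵐ x ∂μ.restrict (S i), f x ∈ B i := by
    refine (ae_map_iff hf.aemeasurable (hBm i)).1 ?_
    rw [hfmap i, ae_map_iff measurable_snd.aemeasurable (hBm i)]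
    exact (ae_restrict_iff' (hDm i)).2 (.of_forall fun x hx => (hD i hx).2)
  refine ⟨f, hf, ?_, ?_⟩
  · rw [← hμ, Measure.map_sum hf.aemeasurable]
    simp_rw [hfmap]
    rw [← Measure.map_sum measurable_snd.aemeasurable, hγ]
  · calc ∫⁻ x, ENNReal.ofReal (c (x, f x)) ∂μ
        = ∑' i, ∫⁻ x in S i, ENNReal.ofReal (c (x, f x)) ∂μ := by
          rw [← lintegral_sum_measure, hμ]
      _ ≤ ∑' i, ∫⁻ p in D i, ENNReal.ofReal (c p) + ENNReal.ofReal ε ∂γ := by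
          refine ENNReal.tsum_le_tsum fun i => ?_
          set a := ⨅ q ∈ D i, (ENNReal.ofReal (c q) + ENNReal.ofReal ε)
          calc ∫⁻ x in S i, ENNReal.ofReal (c (x, f x)) ∂μ
              ≤ ∫⁻ _ in S i, a ∂μ := by
                refine lintegral_mono_ae ?_
                filter_upwards [hfB i, ae_restrict_mem (hSm i)] with x hx hxS
                refine le_iInf₂ fun q hq => ?_
                rw [← ENNReal.ofReal_add (hc0 q) hε.le]
                exact ENNReal.ofReal_le_ofReal (hosc i _ ⟨hSA i hxS, hx⟩ q (hD i hq))
            _ = ∫⁻ _ in D i, a ∂γ := by simp [hSμ i]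
            _ ≤ _ := setLIntegral_mono' (hDm i) fun q hq => iInf₂_le q hq
      _ = ∫⁻ p, ENNReal.ofReal (c p) + ENNReal.ofReal ε ∂γ := by
          rw [← lintegral_sum_measure, hγ]
      _ = _ := by
          rw [lintegral_add_right _ measurable_const, lintegral_const, measure_univ, mul_one]

end AtomlessTransport

/-- **Monge = Kantorovich.** For Polish spaces `X`, `Y`, an atomless Borel probability
measure `μ` on `X`, a Borel probability measure `ν` on `Y`, and a continuous real-valued
nonnegative cost `c`, the infimum of the Monge problem over Borel maps `T` pushing `μ`
forward to `ν` equals the infimum of the Kantorovich problem over couplings. -/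
theorem monge_eq_kantorovich
    {X Y : Type*} [TopologicalSpace X] [PolishSpace X] [MeasurableSpace X] [BorelSpace X]
    [TopologicalSpace Y] [PolishSpace Y] [MeasurableSpace Y] [BorelSpace Y]
    (μ : Measure X) [IsProbabilityMeasure μ] (hμatomless : ∀ x : X, μ {x} = 0)
    (ν : Measure Y) [IsProbabilityMeasure ν]
    (c : X × Y → ℝ) (hc : Continuous c) (hc0 : ∀ p, 0 ≤ c p) :
    (⨅ (T : X → Y) (_ : Measurable T) (_ : μ.map T = ν),
        ∫⁻ x, ENNReal.ofReal (c (x, T x)) ∂μ) =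
      ⨅ γ ∈ Coupling μ ν, ∫⁻ p, ENNReal.ofReal (c p) ∂γ := by
  refine le_antisymm (le_iInf₂ fun γ hγ => ?_) (le_iInf fun T => le_iInf₂ fun hT hTν => ?_)
  · obtain ⟨rfl, rfl⟩ := hγ
    have : IsProbabilityMeasure γ := ⟨by
      rw [← measure_univ (μ := γ.map Prod.fst), Measure.map_apply measurable_fst .univ,
        Set.preimage_univ]⟩
    have : NullSingletonClass (γ.map Prod.fst) := ⟨hμatomless⟩
    refine ENNReal.le_of_forall_pos_le_add fun ε hε _ => ?_
    obtain ⟨T, hT, hTν, hle⟩ := exists_map_lintegral_le γ hc hc0 (NNReal.coe_pos.2 hε)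
    rw [ENNReal.ofReal_coe_nnreal] at hle
    exact (iInf_le_of_le T (iInf₂_le hT hTν)).trans hle
  · have hg : Measurable fun x => (x, T x) := measurable_id.prodMk hT
    refine iInf₂_le_of_le (μ.map fun x => (x, T x)) ⟨?_, ?_⟩ ?_
    · rw [Measure.map_map measurable_fst hg]
      exact Measure.map_id
    · rw [Measure.map_map measurable_snd hg]
      exact hTν
    · rw [lintegral_map hc.measurable.ennreal_ofReal hg]
end
end

section
/- Let X be a Polish metric space and let μ, ν be Borel probability measures on X with finite first moments. Then the Kantorovich–Rubinstein duality holds: W1(μ, ν) = sup { ∫_X φ dμ − ∫_X φ dν : φ : X → ℝ is 1-Lipschitz }. -/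
open MeasureTheory ENNReal

noncomputable section

/-- The Wasserstein-1 distance: the infimum of the transport cost `∫ dist(x, y) dγ`
over all couplings `γ` of `μ` and `ν`. -/
def W1 {X : Type*} [MeasurableSpace X] [PseudoEMetricSpace X]
    (μ ν : Measure X) : ℝ≥0∞ :=
  ⨅ γ ∈ Coupling μ ν, ∫⁻ p : X × X, edist p.1 p.2 ∂γ

/-- A measure has finite first moment if `∫ dist(x, x₀) dμ(x) < ∞` for every `x₀`. -/
def HasFiniteFirstMoment {X : Type*} [MeasurableSpace X] [PseudoEMetricSpace X]
    (μ : Measure X) : Prop :=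
  ∀ x₀ : X, ∫⁻ x, edist x x₀ ∂μ < ⊤

/-- Kantorovich duality for finite transport problems. -/
theorem exists_plan_of_dual_bound {ι κ : Type*} [Fintype ι] [Fintype κ]
    (a : ι → ℝ) (b : κ → ℝ) (ha : ∀ i, 0 ≤ a i) (hb : ∀ j, 0 ≤ b j)
    (ha1 : ∑ i, a i = 1) (hb1 : ∑ j, b j = 1) (c : ι → κ → ℝ) (D : ℝ)
    (hD : ∀ (φ : ι → ℝ) (ψ : κ → ℝ), (∀ i j, φ i + ψ j ≤ c i j) →
      ∑ i, a i * φ i + ∑ j, b j * ψ j ≤ D) :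
    ∃ π : ι × κ → ℝ, (∀ p, 0 ≤ π p) ∧ (∀ i, ∑ j, π (i, j) = a i) ∧
      (∀ j, ∑ i, π (i, j) = b j) ∧ ∑ p, π p * c p.1 p.2 ≤ D := by
  classical
  let L : (ι × κ → ℝ) → (ι → ℝ) × (κ → ℝ) × ℝ := fun π ↦
    (fun i ↦ ∑ j, π (i, j), fun j ↦ ∑ i, π (i, j), ∑ p, π p * c p.1 p.2)
  have hL : IsLinearMap ℝ L := by
    constructor
    · intro x y
      simp [L, Finset.sum_add_distrib, add_mul, funext_iff]
    · intro r x
      simp [L, Finset.mul_sum, mul_assoc, funext_iff]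
  have hLc : Continuous L := by fun_prop
  by_cases hdisj : Disjoint (L '' stdSimplex ℝ (ι × κ)) ({a} ×ˢ {b} ×ˢ Set.Iic D)
  · exfalso
    obtain ⟨f, s, u, hs, hsu, hu⟩ := geometric_hahn_banach_compact_closed
      ((convex_stdSimplex ℝ (ι × κ)).is_linear_image hL)
      ((isCompact_stdSimplex ℝ (ι × κ)).image hLc)
      ((convex_singleton a).prod ((convex_singleton b).prod (convex_Iic D)))
      (isClosed_singleton.prod (isClosed_singleton.prod isClosed_Iic)) hdisj
    set φ : ι → ℝ := fun i ↦ f (Pi.single i 1, 0, 0)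
    set ψ : κ → ℝ := fun j ↦ f (0, Pi.single j 1, 0)
    set l : ℝ := f (0, 0, 1)
    have hf : ∀ x y t, f (x, y, t) = ∑ i, x i * φ i + ∑ j, y j * ψ j + t * l := by
      intro x y t
      have h1 : (x, y, t) = ∑ i, x i • (Pi.single i (1 : ℝ), (0 : κ → ℝ), (0 : ℝ)) +
          ∑ j, y j • ((0 : ι → ℝ), Pi.single j (1 : ℝ), (0 : ℝ)) +
          t • ((0 : ι → ℝ), (0 : κ → ℝ), (1 : ℝ)) := by
        refine Prod.ext ?_ (Prod.ext ?_ ?_)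
        · ext k; simp [Prod.fst_sum, Pi.single_apply]
        · ext k; simp [Prod.fst_sum, Prod.snd_sum, Pi.single_apply]
        · simp [Prod.snd_sum]
      rw [h1]
      simp only [map_add, map_sum, map_smul, smul_eq_mul, φ, ψ, l]
    have hpt : ∀ i j, φ i + ψ j + c i j * l < s := by
      intro i j
      have := hs _ ⟨Pi.single (i, j) 1, single_mem_stdSimplex ℝ (i, j), rfl⟩
      have e : L (Pi.single (i, j) 1) = (Pi.single i 1, Pi.single j 1, c i j) := by
        refine Prod.ext ?_ (Prod.ext ?_ ?_)
        · ext k; simp [L, Pi.single_apply, ite_and, eq_comm]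
        · ext k; simp [L, Pi.single_apply, ite_and, eq_comm]
        · simp [L, Pi.single_apply]
      rw [e, hf] at this
      simpa [Pi.single_apply] using this
    have hray : ∀ t ≤ D, u < ∑ i, a i * φ i + ∑ j, b j * ψ j + t * l := by
      intro t ht
      rw [← hf]
      exact hu _ ⟨rfl, rfl, ht⟩
    have hsum : ∀ (x : ι → ℝ) (y : κ → ℝ) (r : ℝ), (∀ i j, x i + y j ≤ r) →
        ∑ i, a i * x i + ∑ j, b j * y j ≤ r := by
      intro x y r h
      have h1 : ∀ i, x i + ∑ j, b j * y j ≤ r := by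
        intro i
        calc x i + ∑ j, b j * y j = ∑ j, b j * (x i + y j) := by
              simp [mul_add, Finset.sum_add_distrib, ← Finset.sum_mul, hb1]
          _ ≤ ∑ j, b j * r := by gcongr with j; exacts [hb j, h i j]
          _ = r := by rw [← Finset.sum_mul, hb1, one_mul]
      calc ∑ i, a i * x i + ∑ j, b j * y j = ∑ i, a i * (x i + ∑ j, b j * y j) := by
            simp [mul_add, Finset.sum_add_distrib, ← Finset.sum_mul, ha1]
        _ ≤ ∑ i, a i * r := by gcongr with i; exacts [ha i, h1 i]
        _ = r := by rw [← Finset.sum_mul, ha1, one_mul]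
    have hDl := hray D le_rfl
    rcases lt_trichotomy l 0 with hl | hl | hl
    · have h1 := hD (fun i ↦ (φ i - s) / (-l)) (fun j ↦ ψ j / (-l)) (fun i j ↦ by
        rw [← add_div, div_le_iff₀ (by linarith)]
        linarith [hpt i j])
      have h2 : ∑ i, a i * ((φ i - s) / (-l)) + ∑ j, b j * (ψ j / (-l)) =
          (∑ i, a i * φ i - s + ∑ j, b j * ψ j) / (-l) := by
        simp only [← mul_div_assoc, ← Finset.sum_div, mul_sub, Finset.sum_sub_distrib,
          ← Finset.sum_mul, ha1, one_mul, ← add_div]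
      rw [h2, div_le_iff₀ (by linarith)] at h1
      linarith
    · have := hsum φ ψ s fun i j ↦ by simpa [hl] using (hpt i j).le
      rw [hl] at hDl
      linarith
    · set A := ∑ i, a i * φ i + ∑ j, b j * ψ j
      have := hray (min D ((u - A) / l)) (min_le_left _ _)
      have h2 : min D ((u - A) / l) * l ≤ (u - A) / l * l := by gcongr; exact min_le_right _ _
      rw [div_mul_cancel₀ _ hl.ne'] at h2
      linarith
  · obtain ⟨_, ⟨π, hπ, rfl⟩, h1, h2, h3⟩ := Set.not_disjoint_iff.1 hdisj
    exact ⟨π, hπ.1, congr_fun h1, congr_fun h2, h3⟩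

/-- A discrete plan between the laws of `S` and `T` lifts to a coupling of `μ` and `ν`. -/
theorem exists_coupling_of_plan {X Y ι κ : Type*} [MeasurableSpace X] [MeasurableSpace Y]
    [Fintype ι] [Fintype κ] [MeasurableSpace ι] [MeasurableSpace κ]
    [MeasurableSingletonClass ι] [MeasurableSingletonClass κ]
    (μ : Measure X) (ν : Measure Y) [IsFiniteMeasure μ] [IsFiniteMeasure ν]
    {S : X → ι} {T : Y → κ} (hS : Measurable S) (hT : Measurable T) (π : ι × κ → ℝ≥0∞)
    (hπ₁ : ∀ i, ∑ j, π (i, j) = μ (S ⁻¹' {i})) (hπ₂ : ∀ j, ∑ i, π (i, j) = ν (T ⁻¹' {j})) :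
    ∃ γ ∈ Coupling μ ν, ∀ p, γ.map (Prod.map S T) {p} = π p := by
  classical
  have mS : ∀ i, MeasurableSet (S ⁻¹' {i}) := fun i ↦ hS (measurableSet_singleton i)
  have mT : ∀ j, MeasurableSet (T ⁻¹' {j}) := fun j ↦ hT (measurableSet_singleton j)
  have hμ : ∀ p : ι × κ, π p * ProbabilityTheory.cond μ (S ⁻¹' {p.1}) (S ⁻¹' {p.1}) = π p := by
    rintro ⟨i, j⟩
    by_cases h : μ (S ⁻¹' {i}) = 0
    · have h0 : π (i, j) = 0 := by
        rw [← hπ₁, Finset.sum_eq_zero_iff] at h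
        exact h j (Finset.mem_univ j)
      simp [h0]
    · rw [ProbabilityTheory.cond_apply_self h (measure_ne_top _ _), mul_one]
  have hν : ∀ p : ι × κ, π p * ProbabilityTheory.cond ν (T ⁻¹' {p.2}) (T ⁻¹' {p.2}) = π p := by
    rintro ⟨i, j⟩
    by_cases h : ν (T ⁻¹' {j}) = 0
    · have h0 : π (i, j) = 0 := by
        rw [← hπ₂, Finset.sum_eq_zero_iff] at h
        exact h i (Finset.mem_univ i)
      simp [h0]
    · rw [ProbabilityTheory.cond_apply_self h (measure_ne_top _ _), mul_one]
  have hμu : ∀ i, ProbabilityTheory.cond μ (S ⁻¹' {i}) Set.univ =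
      ProbabilityTheory.cond μ (S ⁻¹' {i}) (S ⁻¹' {i}) := fun i ↦ by
    simp [ProbabilityTheory.cond_apply (mS i)]
  have hνu : ∀ j, ProbabilityTheory.cond ν (T ⁻¹' {j}) Set.univ =
      ProbabilityTheory.cond ν (T ⁻¹' {j}) (T ⁻¹' {j}) := fun j ↦ by
    simp [ProbabilityTheory.cond_apply (mT j)]
  let γ : Measure (X × Y) := ∑ p : ι × κ, π p •
    (ProbabilityTheory.cond μ (S ⁻¹' {p.1})).prod (ProbabilityTheory.cond ν (T ⁻¹' {p.2}))
  have hγ : ∀ (s : Set X) (t : Set Y), γ (s ×ˢ t) = ∑ p : ι × κ, π p *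
      (ProbabilityTheory.cond μ (S ⁻¹' {p.1}) s * ProbabilityTheory.cond ν (T ⁻¹' {p.2}) t) := by
    intro s t
    simp [γ, Measure.finsetSum_apply, Measure.prod_prod]
  refine ⟨γ, ⟨?_, ?_⟩, ?_⟩
  · ext s hs
    rw [Measure.map_apply measurable_fst hs, ← Set.prod_univ, hγ]
    calc ∑ p : ι × κ, π p * (ProbabilityTheory.cond μ (S ⁻¹' {p.1}) s *
          ProbabilityTheory.cond ν (T ⁻¹' {p.2}) Set.univ)
        = ∑ p : ι × κ, π p * ProbabilityTheory.cond μ (S ⁻¹' {p.1}) s := by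
          refine Finset.sum_congr rfl fun p _ ↦ ?_
          rw [hνu, mul_comm (ProbabilityTheory.cond μ _ s), ← mul_assoc, hν]
      _ = ∑ i, μ (S ⁻¹' {i} ∩ s) := by
          rw [Fintype.sum_prod_type]
          refine Finset.sum_congr rfl fun i _ ↦ ?_
          dsimp only
          rw [← Finset.sum_mul, hπ₁, mul_comm, ProbabilityTheory.cond_mul_eq_inter (mS i)]
      _ = μ s := by
          have := sum_measure_preimage_singleton (μ := μ.restrict s) (f := S) Finset.univ
            fun i _ ↦ mS i
          simpa [Measure.restrict_apply (mS _)] using this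
  · ext t ht
    rw [Measure.map_apply measurable_snd ht, ← Set.univ_prod, hγ]
    calc ∑ p : ι × κ, π p * (ProbabilityTheory.cond μ (S ⁻¹' {p.1}) Set.univ *
          ProbabilityTheory.cond ν (T ⁻¹' {p.2}) t)
        = ∑ p : ι × κ, π p * ProbabilityTheory.cond ν (T ⁻¹' {p.2}) t := by
          refine Finset.sum_congr rfl fun p _ ↦ ?_
          rw [hμu, ← mul_assoc, hμ]
      _ = ∑ j, ν (T ⁻¹' {j} ∩ t) := by
          rw [Fintype.sum_prod_type_right]
          refine Finset.sum_congr rfl fun j _ ↦ ?_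
          dsimp only
          rw [← Finset.sum_mul, hπ₂, mul_comm, ProbabilityTheory.cond_mul_eq_inter (mT j)]
      _ = ν t := by
          have := sum_measure_preimage_singleton (μ := ν.restrict t) (f := T) Finset.univ
            fun j _ ↦ mT j
          simpa [Measure.restrict_apply (mT _)] using this
  · rintro ⟨k, l⟩
    rw [Measure.map_apply (hS.prodMap hT) (measurableSet_singleton _),
      ← Set.singleton_prod_singleton]
    change γ ((S ⁻¹' {k}) ×ˢ (T ⁻¹' {l})) = _
    rw [hγ, Finset.sum_eq_single (k, l)]
    · rw [← mul_assoc, hμ, hν]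
    · rintro ⟨i, j⟩ - hij
      by_cases hik : i = k
      · have hjl : j ≠ l := fun h ↦ hij (by rw [hik, h])
        have : T ⁻¹' {j} ∩ T ⁻¹' {l} = ∅ :=
          ((Set.disjoint_singleton.2 hjl).preimage T).inter_eq
        simp [ProbabilityTheory.cond_apply (mT j), this]
      · have : S ⁻¹' {i} ∩ S ⁻¹' {k} = ∅ :=
          ((Set.disjoint_singleton.2 hik).preimage S).inter_eq
        simp [ProbabilityTheory.cond_apply (mS i), this]
    · simp

theorem HasFiniteFirstMoment.integrable {X : Type*} [PseudoMetricSpace X] [MeasurableSpace X]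
    [OpensMeasurableSpace X] {μ : Measure X} [IsFiniteMeasure μ] (hμ : HasFiniteFirstMoment μ)
    {φ : X → ℝ} (hφ : LipschitzWith 1 φ) : Integrable φ μ := by
  rcases isEmpty_or_nonempty X with hX | ⟨⟨x₀⟩⟩
  · simp [Measure.eq_zero_of_isEmpty μ]
  refine ⟨hφ.continuous.measurable.aestronglyMeasurable, ?_⟩
  calc ∫⁻ x, ‖φ x‖ₑ ∂μ ≤ ∫⁻ x, (edist x x₀ + ‖φ x₀‖ₑ) ∂μ := by
        refine lintegral_mono fun x ↦ ?_
        calc ‖φ x‖ₑ = ‖(φ x - φ x₀) + φ x₀‖ₑ := by rw [sub_add_cancel]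
          _ ≤ ‖φ x - φ x₀‖ₑ + ‖φ x₀‖ₑ := enorm_add_le _ _
          _ ≤ edist x x₀ + ‖φ x₀‖ₑ := by
            gcongr
            simpa [edist_eq_enorm_sub] using hφ x x₀
    _ < ⊤ := by
        rw [lintegral_add_right _ measurable_const, lintegral_const]
        exact ENNReal.add_lt_top.2 ⟨hμ x₀, ENNReal.mul_lt_top enorm_lt_top (measure_lt_top _ _)⟩

theorem abs_integral_sub_le_of_lintegral_edist_le {Ω X : Type*} [MeasurableSpace Ω]
    [PseudoMetricSpace X] {P : Measure Ω} {f g : Ω → X} {φ : X → ℝ} (hφ : LipschitzWith 1 φ)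
    (hf : Integrable (fun ω ↦ φ (f ω)) P) (hg : Integrable (fun ω ↦ φ (g ω)) P) {ε : ℝ}
    (hε : 0 ≤ ε) (h : ∫⁻ ω, edist (f ω) (g ω) ∂P ≤ ENNReal.ofReal ε) :
    |∫ ω, φ (f ω) ∂P - ∫ ω, φ (g ω) ∂P| ≤ ε := by
  rw [← integral_sub hf hg, ← ENNReal.ofReal_le_ofReal_iff hε, ← Real.enorm_eq_ofReal_abs]
  refine (enorm_integral_le_lintegral_enorm _).trans (le_trans (lintegral_mono fun ω ↦ ?_) h)
  simpa [edist_eq_enorm_sub] using hφ (f ω) (g ω)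

/-- The easy inequality of Kantorovich–Rubinstein duality. -/
theorem ofReal_integral_sub_le_W1 {X : Type*} [PseudoMetricSpace X] [MeasurableSpace X]
    [OpensMeasurableSpace X] {μ ν : Measure X} [IsFiniteMeasure μ] [IsFiniteMeasure ν]
    (hμ : HasFiniteFirstMoment μ) (hν : HasFiniteFirstMoment ν)
    {φ : X → ℝ} (hφ : LipschitzWith 1 φ) :
    ENNReal.ofReal (∫ x, φ x ∂μ - ∫ x, φ x ∂ν) ≤ W1 μ ν := by
  refine le_iInf₂ fun γ hγ ↦ ?_
  obtain ⟨rfl, rfl⟩ := hγ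
  by_cases htop : ∫⁻ p : X × X, edist p.1 p.2 ∂γ = ⊤
  · simp [htop]
  have h1 := (hμ.integrable hφ).comp_measurable measurable_fst
  have h2 := (hν.integrable hφ).comp_measurable measurable_snd
  rw [integral_map measurable_fst.aemeasurable (hμ.integrable hφ).aestronglyMeasurable,
    integral_map measurable_snd.aemeasurable (hν.integrable hφ).aestronglyMeasurable]
  refine ENNReal.ofReal_le_of_le_toReal ((le_abs_self _).trans ?_)
  exact abs_integral_sub_le_of_lintegral_edist_le hφ h1 h2 toReal_nonneg
    (ENNReal.ofReal_toReal htop).ge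

/-- A measure with finite first moment is approximated by its images under finite-valued maps. -/
theorem HasFiniteFirstMoment.exists_simpleFunc {X : Type*} [PseudoMetricSpace X]
    [SecondCountableTopology X] [Nonempty X] [MeasurableSpace X] [OpensMeasurableSpace X]
    {μ : Measure X} (hμ : HasFiniteFirstMoment μ) {ε : ℝ≥0∞} (hε : ε ≠ 0) :
    ∃ S : SimpleFunc X X, ∫⁻ x, edist (S x) x ∂μ ≤ ε := by
  let e := TopologicalSpace.denseSeq X
  have h : Filter.Tendsto (fun n ↦ ∫⁻ x, edist (SimpleFunc.nearestPt e n x) x ∂μ) Filter.atTop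
      (nhds (∫⁻ _, 0 ∂μ)) := by
    refine tendsto_lintegral_of_dominated_convergence (fun x ↦ edist x (e 0)) (fun n ↦ ?_)
      (fun n ↦ .of_forall fun x ↦ ?_) (hμ (e 0)).ne (.of_forall fun x ↦ ?_)
    · exact (SimpleFunc.measurable _).edist measurable_id
    · exact (SimpleFunc.edist_nearestPt_le e x (Nat.zero_le n)).trans_eq (edist_comm _ _)
    · have hx : x ∈ closure (Set.range e) := TopologicalSpace.denseRange_denseSeq X x
      simpa using (SimpleFunc.tendsto_nearestPt hx).edist
        (tendsto_const_nhds (x := x) (f := Filter.atTop))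
  rw [lintegral_zero] at h
  obtain ⟨n, hn⟩ := (h.eventually_le_const (pos_iff_ne_zero.2 hε)).exists
  exact ⟨_, hn⟩

theorem HasFiniteFirstMoment.add {X : Type*} [PseudoEMetricSpace X] [MeasurableSpace X]
    {μ ν : Measure X} (hμ : HasFiniteFirstMoment μ) (hν : HasFiniteFirstMoment ν) :
    HasFiniteFirstMoment (μ + ν) := fun x₀ ↦ by
  rw [lintegral_add_measure]
  exact ENNReal.add_lt_top.2 ⟨hμ x₀, hν x₀⟩

theorem exists_lipschitz_between {X ι : Type*} [PseudoMetricSpace X] [Finite ι] [Nonempty ι]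
    (e : ι → X) (φ ψ : ι → ℝ) (h : ∀ i j, φ i + ψ j ≤ dist (e i) (e j)) :
    ∃ f : X → ℝ, LipschitzWith 1 f ∧ ∀ i, φ i ≤ f (e i) ∧ ψ i ≤ -f (e i) := by
  have hbdd : ∀ x, BddBelow (Set.range fun j ↦ dist x (e j) - ψ j) := fun x ↦
    (Set.finite_range _).bddBelow
  refine ⟨fun x ↦ ⨅ j, (dist x (e j) - ψ j), LipschitzWith.of_le_add fun x y ↦ ?_,
    fun i ↦ ⟨le_ciInf fun j ↦ ?_, ?_⟩⟩
  · rw [← sub_le_iff_le_add]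
    refine le_ciInf fun j ↦ ?_
    linarith [ciInf_le (hbdd x) j, dist_triangle x y (e j)]
  · linarith [h i j]
  · have := ciInf_le (hbdd (e i)) i
    rw [dist_self] at this
    linarith

theorem W1_le_of_simpleFunc {X : Type*} [PseudoMetricSpace X] [SecondCountableTopology X]
    [MeasurableSpace X] [BorelSpace X] [MeasurableSingletonClass X]
    {μ ν : Measure X} [IsProbabilityMeasure μ] [IsProbabilityMeasure ν]
    (hμ : HasFiniteFirstMoment μ) (hν : HasFiniteFirstMoment ν) (S : SimpleFunc X X)
    {ε : ℝ} (hε : 0 ≤ ε) (hSμ : ∫⁻ x, edist (S x) x ∂μ ≤ ENNReal.ofReal ε)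
    (hSν : ∫⁻ x, edist (S x) x ∂ν ≤ ENNReal.ofReal ε) {D : ℝ}
    (hD : ∀ φ : X → ℝ, LipschitzWith 1 φ → ∫ x, φ x ∂μ - ∫ x, φ x ∂ν ≤ D) :
    W1 μ ν ≤ ENNReal.ofReal (D + 4 * ε) := by
  have hne : Nonempty X := μ.nonempty_of_neZero
  let ι := S.range
  let T : X → ι := fun x ↦ ⟨S x, S.mem_range_self x⟩
  have hT : Measurable T := S.measurable.subtype_mk
  have : Nonempty ι := ⟨T hne.some⟩
  have hsum : ∀ (P : Measure X) [IsFiniteMeasure P] (g : ι → ℝ),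
      ∑ i, P.real (T ⁻¹' {i}) * g i = ∫ x, g (T x) ∂P := by
    intro P _ g
    rw [← integral_map (φ := T) (f := g) hT.aemeasurable
      (measurable_of_finite g).aestronglyMeasurable, integral_fintype .of_finite]
    simp [map_measureReal_apply hT (measurableSet_singleton _)]
  have hone : ∀ (P : Measure X) [IsProbabilityMeasure P], ∑ i, P.real (T ⁻¹' {i}) = 1 := by
    intro P _
    simpa using hsum P fun _ ↦ 1
  have happ : ∀ (P : Measure X) [IsFiniteMeasure P], HasFiniteFirstMoment P →
      ∫⁻ x, edist (S x) x ∂P ≤ ENNReal.ofReal ε → ∀ f : X → ℝ, LipschitzWith 1 f →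
      |∫ x, f (S x) ∂P - ∫ x, f x ∂P| ≤ ε := by
    intro P _ hP hSP f hf
    exact abs_integral_sub_le_of_lintegral_edist_le (g := fun x ↦ x) hf
      (S.map f).integrable_of_isFiniteMeasure (hP.integrable hf) hε hSP
  obtain ⟨π, hπ0, hπ₁, hπ₂, hπc⟩ := exists_plan_of_dual_bound
    (fun i : ι ↦ μ.real (T ⁻¹' {i})) (fun i : ι ↦ ν.real (T ⁻¹' {i}))
    (fun _ ↦ measureReal_nonneg) (fun _ ↦ measureReal_nonneg) (hone μ) (hone ν)
    (fun i j ↦ dist (i : X) j) (D + 2 * ε) (fun φ ψ h ↦ by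
      obtain ⟨f, hf, hφψ⟩ := exists_lipschitz_between (fun i : ι ↦ (i : X)) φ ψ h
      have h1 : ∑ i : ι, μ.real (T ⁻¹' {i}) * φ i ≤ ∫ x, f (S x) ∂μ := by
        rw [← hsum μ fun i ↦ f i]
        gcongr with i
        exact (hφψ i).1
      have h2 : ∑ i : ι, ν.real (T ⁻¹' {i}) * ψ i ≤ - ∫ x, f (S x) ∂ν := by
        rw [← hsum ν fun i ↦ f i, ← Finset.sum_neg_distrib]
        simp_rw [← mul_neg]
        gcongr with i
        exact (hφψ i).2
      have h3 := abs_le.1 (happ μ hμ hSμ f hf)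
      have h4 := abs_le.1 (happ ν hν hSν f hf)
      linarith [hD f hf, h3.2, h4.1])
  have hofReal : ∀ (P : Measure X) [IsFiniteMeasure P] (i : ι) (w : ι → ℝ), (∀ j, 0 ≤ w j) →
      ∑ j, w j = P.real (T ⁻¹' {i}) → ∑ j, ENNReal.ofReal (w j) = P (T ⁻¹' {i}) := by
    intro P _ i w hw h
    rw [← ENNReal.ofReal_sum_of_nonneg fun j _ ↦ hw j, h, ofReal_measureReal]
  obtain ⟨γ, hγ, hγπ⟩ := exists_coupling_of_plan μ ν hT hT (fun p ↦ ENNReal.ofReal (π p))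
    (fun i ↦ hofReal μ i _ (fun _ ↦ hπ0 _) (hπ₁ i)) (fun j ↦ hofReal ν j _ (fun _ ↦ hπ0 _) (hπ₂ j))
  have hmeas : Measurable fun x ↦ edist (S x) x := S.measurable.edist measurable_id
  have hD0 : 0 ≤ D := by simpa using hD (fun _ ↦ 0) (LipschitzWith.const' 0)
  have hmid : ∫⁻ p : X × X, edist (S p.1) (S p.2) ∂γ ≤ ENNReal.ofReal (D + 2 * ε) := by
    have hg : Measurable fun q : ι × ι ↦ edist (q.1 : X) q.2 := measurable_of_finite _
    calc ∫⁻ p : X × X, edist (S p.1) (S p.2) ∂γ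
        = ∫⁻ q, edist (q.1 : X) q.2 ∂γ.map (Prod.map T T) :=
          (lintegral_map hg (hT.prodMap hT)).symm
      _ = ∑ q : ι × ι, ENNReal.ofReal (π q * dist (q.1 : X) q.2) := by
          rw [lintegral_fintype]
          refine Finset.sum_congr rfl fun q _ ↦ ?_
          rw [hγπ, edist_dist, mul_comm, ENNReal.ofReal_mul (hπ0 q)]
      _ ≤ ENNReal.ofReal (D + 2 * ε) := by
          rw [← ENNReal.ofReal_sum_of_nonneg fun q _ ↦ mul_nonneg (hπ0 q) dist_nonneg]
          exact ENNReal.ofReal_le_ofReal hπc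
  calc W1 μ ν ≤ ∫⁻ p : X × X, edist p.1 p.2 ∂γ := iInf₂_le γ hγ
    _ ≤ ∫⁻ p : X × X, (edist (S p.1) p.1 + (edist (S p.1) (S p.2) + edist (S p.2) p.2)) ∂γ := by
        refine lintegral_mono fun p ↦ ?_
        refine (edist_triangle_left _ _ (S p.1)).trans ?_
        gcongr
        exact edist_triangle _ _ _
    _ = ∫⁻ p : X × X, edist (S p.1) p.1 ∂γ +
          (∫⁻ p : X × X, edist (S p.1) (S p.2) ∂γ + ∫⁻ p : X × X, edist (S p.2) p.2 ∂γ) := by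
        rw [lintegral_add_left (by exact hmeas.comp measurable_fst),
          lintegral_add_right _ (by exact hmeas.comp measurable_snd)]
    _ = ∫⁻ x, edist (S x) x ∂μ +
          (∫⁻ p : X × X, edist (S p.1) (S p.2) ∂γ + ∫⁻ x, edist (S x) x ∂ν) := by
        conv_rhs => rw [← hγ.1, ← hγ.2]
        rw [lintegral_map hmeas measurable_fst, lintegral_map hmeas measurable_snd]
    _ ≤ ENNReal.ofReal ε + (ENNReal.ofReal (D + 2 * ε) + ENNReal.ofReal ε) := by gcongr
    _ = ENNReal.ofReal (D + 4 * ε) := by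
        rw [← ENNReal.ofReal_add (by positivity) hε, ← ENNReal.ofReal_add hε (by positivity)]
        ring_nf

/-- **Kantorovich–Rubinstein duality.** For Borel probability measures with finite first
moments on a Polish metric space, `W1(μ, ν)` equals the supremum of
`∫ φ dμ − ∫ φ dν` over all 1-Lipschitz functions `φ : X → ℝ`. -/
theorem kantorovich_rubinstein
    {X : Type*} [MetricSpace X] [PolishSpace X] [MeasurableSpace X] [BorelSpace X]
    (μ ν : Measure X) [IsProbabilityMeasure μ] [IsProbabilityMeasure ν]
    (hμ : HasFiniteFirstMoment μ) (hν : HasFiniteFirstMoment ν) :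
    W1 μ ν = ⨆ (φ : X → ℝ) (_ : LipschitzWith 1 φ),
      ENNReal.ofReal (∫ x, φ x ∂μ - ∫ x, φ x ∂ν) := by
  refine le_antisymm ?_ (iSup₂_le fun φ hφ ↦ ofReal_integral_sub_le_W1 hμ hν hφ)
  by_cases htop : (⨆ (φ : X → ℝ) (_ : LipschitzWith 1 φ),
      ENNReal.ofReal (∫ x, φ x ∂μ - ∫ x, φ x ∂ν)) = ⊤
  · simp [htop]
  rw [← ENNReal.ofReal_toReal htop]
  set D : ℝ := (⨆ (φ : X → ℝ) (_ : LipschitzWith 1 φ),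
      ENNReal.ofReal (∫ x, φ x ∂μ - ∫ x, φ x ∂ν)).toReal
  have hD : ∀ φ : X → ℝ, LipschitzWith 1 φ → ∫ x, φ x ∂μ - ∫ x, φ x ∂ν ≤ D := fun φ hφ ↦
    (ENNReal.ofReal_le_iff_le_toReal htop).1
      (le_iSup₂ (f := fun (φ : X → ℝ) (_ : LipschitzWith 1 φ) ↦
        ENNReal.ofReal (∫ x, φ x ∂μ - ∫ x, φ x ∂ν)) φ hφ)
  have hne : Nonempty X := μ.nonempty_of_neZero
  refine ENNReal.le_of_forall_pos_le_add fun ε hε _ ↦ ?_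
  obtain ⟨S, hS⟩ := (hμ.add hν).exists_simpleFunc (ε := ENNReal.ofReal (ε / 4))
    (by simpa using hε)
  rw [lintegral_add_measure] at hS
  calc W1 μ ν ≤ ENNReal.ofReal (D + 4 * (ε / 4)) :=
        W1_le_of_simpleFunc hμ hν S (by positivity) (le_self_add.trans hS)
          (le_add_self.trans hS) hD
    _ = ENNReal.ofReal D + ε := by
        rw [mul_div_cancel₀ _ (by norm_num), ENNReal.ofReal_add toReal_nonneg ε.coe_nonneg,
          ENNReal.ofReal_coe_nnreal]
end
end

section
/- Let μ0 and μ1 be Borel probability measures on Euclidean space ℝ^N with finite first moments, let γ be an optimal coupling of μ0 and μ1 for the Wasserstein-1 distance, and for t ∈ [0,1] let σ_t = (e_t)♯γ with e_t(x, y) = (1 − t)x + t y. Then the transport cost is additive along this displacement interpolation: for all 0 ≤ t1 ≤ t2 ≤ t3 ≤ 1, W1(σ_{t1}, σ_{t2}) + W1(σ_{t2}, σ_{t3}) = W1(σ_{t1}, σ_{t3}). -/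
open MeasureTheory ENNReal

noncomputable section

open ProbabilityTheory in
/-- **Gluing**: two couplings with a common middle marginal are the pair marginals of
a measure on the triple product. -/
theorem exists_gluing {X Y Z : Type*} [MeasurableSpace X] [MeasurableSpace Y]
    [MeasurableSpace Z] [StandardBorelSpace Z] [Nonempty Z]
    (α : Measure (X × Y)) (β : Measure (Y × Z)) [SFinite α] [IsFiniteMeasure β]
    (h : α.map Prod.snd = β.map Prod.fst) :
    ∃ π : Measure ((X × Y) × Z),
      π.map Prod.fst = α ∧ π.map (fun q => (q.1.2, q.2)) = β := by
  refine ⟨α ⊗ₘ (β.condKernel.prodMkLeft X), Measure.fst_compProd α _, ?_⟩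
  have hβ : (α.map Prod.snd) ⊗ₘ β.condKernel = β := by
    rw [h]; exact β.disintegrate β.condKernel
  conv_rhs => rw [← hβ]
  have hg : Measurable fun q : (X × Y) × Z => (q.1.2, q.2) := by fun_prop
  have : SFinite (α.map Prod.snd) := by rw [h]; infer_instance
  ext s hs
  rw [Measure.map_apply hg hs, Measure.compProd_apply (hg hs), Measure.compProd_apply hs,
    lintegral_map (Kernel.measurable_kernel_prodMk_left hs) measurable_snd]
  rfl

theorem Coupling.isProbabilityMeasure {X Y : Type*} [MeasurableSpace X] [MeasurableSpace Y]
    {μ : Measure X} {ν : Measure Y} [IsProbabilityMeasure μ] {γ : Measure (X × Y)}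
    (hγ : γ ∈ Coupling μ ν) : IsProbabilityMeasure γ := by
  constructor
  have h : γ.map Prod.fst Set.univ = 1 := by rw [hγ.1]; exact measure_univ
  rwa [Measure.map_apply measurable_fst MeasurableSet.univ, Set.preimage_univ] at h

theorem W1_le_lintegral_edist {X Ω : Type*} [MeasurableSpace X] [PseudoEMetricSpace X]
    [OpensMeasurableSpace X] [SecondCountableTopology X] [MeasurableSpace Ω] (π : Measure Ω)
    {f g : Ω → X} (hf : Measurable f) (hg : Measurable g) :
    W1 (π.map f) (π.map g) ≤ ∫⁻ ω, edist (f ω) (g ω) ∂π := by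
  have hfg : Measurable fun ω => (f ω, g ω) := hf.prodMk hg
  refine (iInf₂_le (π.map fun ω => (f ω, g ω)) ⟨?_, ?_⟩).trans_eq ?_
  · rw [lintegral_map (by fun_prop) hfg]
  · rw [Measure.map_map measurable_fst hfg]; rfl
  · rw [Measure.map_map measurable_snd hfg]; rfl

theorem W1_triangle {X : Type*} [MeasurableSpace X] [PseudoEMetricSpace X]
    [OpensMeasurableSpace X] [SecondCountableTopology X] [StandardBorelSpace X] [Nonempty X]
    (μ ν ρ : Measure X) [IsProbabilityMeasure μ] [IsProbabilityMeasure ν] :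
    W1 μ ρ ≤ W1 μ ν + W1 ν ρ := by
  conv_rhs => simp only [W1]
  refine ENNReal.le_iInf₂_add_iInf₂ fun α hα β hβ => ?_
  have := Coupling.isProbabilityMeasure hα
  have := Coupling.isProbabilityMeasure hβ
  obtain ⟨π, rfl, rfl⟩ := exists_gluing α β (hα.2.trans hβ.1.symm)
  have hg : Measurable fun q : (X × X) × X => (q.1.2, q.2) := by fun_prop
  obtain ⟨rfl, -⟩ := hα
  obtain ⟨-, rfl⟩ := hβ
  rw [lintegral_map (by fun_prop) measurable_fst, lintegral_map (by fun_prop) hg,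
    Measure.map_map measurable_fst measurable_fst, Measure.map_map measurable_snd hg,
    ← lintegral_add_left (by fun_prop)]
  exact (W1_le_lintegral_edist π (by fun_prop) (by fun_prop)).trans
    (lintegral_mono fun q => edist_triangle _ _ _)

theorem Coupling.lintegral_edist_lt_top {X : Type*} [MeasurableSpace X] [PseudoEMetricSpace X]
    [OpensMeasurableSpace X] [Nonempty X] {μ ν : Measure X}
    (hμ : HasFiniteFirstMoment μ) (hν : HasFiniteFirstMoment ν)
    {γ : Measure (X × X)} (hγ : γ ∈ Coupling μ ν) :
    ∫⁻ p, edist p.1 p.2 ∂γ < ⊤ := by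
  obtain ⟨x₀⟩ := ‹Nonempty X›
  have h₁ := hμ x₀
  have h₂ := hν x₀
  rw [← hγ.1, lintegral_map (by fun_prop) measurable_fst] at h₁
  rw [← hγ.2, lintegral_map (by fun_prop) measurable_snd] at h₂
  refine lt_of_le_of_lt ?_ (ENNReal.add_lt_top.2 ⟨h₁, h₂⟩)
  rw [← lintegral_add_left (by fun_prop)]
  exact lintegral_mono fun p => edist_triangle_right _ _ _

theorem edist_interpolation {E : Type*} [SeminormedAddCommGroup E] [NormedSpace ℝ E]
    (x y : E) {s t : ℝ} (hst : s ≤ t) :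
    edist ((1 - s) • x + s • y) ((1 - t) • x + t • y) = ENNReal.ofReal (t - s) * edist x y := by
  have h : (1 - s) • x + s • y - ((1 - t) • x + t • y) = (t - s) • (x - y) := by module
  rw [edist_dist, edist_dist, ← ENNReal.ofReal_mul (sub_nonneg.2 hst), dist_eq_norm, h, norm_smul,
    Real.norm_of_nonneg (sub_nonneg.2 hst), dist_eq_norm]

/-- **Additivity of transport cost along displacement interpolation.** If `γ` is an
optimal coupling of `μ₀` and `μ₁` for the Wasserstein-1 distance and
`σ t = (e_t)♯γ` with `e_t (x, y) = (1 − t) x + t y`, then for all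
`0 ≤ t₁ ≤ t₂ ≤ t₃ ≤ 1`, `W1 (σ t₁) (σ t₂) + W1 (σ t₂) (σ t₃) = W1 (σ t₁) (σ t₃)`. -/
theorem displacement_interpolation_additive
    {N : ℕ} (μ₀ μ₁ : Measure (EuclideanSpace ℝ (Fin N)))
    [IsProbabilityMeasure μ₀] [IsProbabilityMeasure μ₁]
    (h₀ : HasFiniteFirstMoment μ₀) (h₁ : HasFiniteFirstMoment μ₁)
    (γ : Measure (EuclideanSpace ℝ (Fin N) × EuclideanSpace ℝ (Fin N)))
    (hγ : γ ∈ Coupling μ₀ μ₁)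
    (hopt : ∫⁻ p, edist p.1 p.2 ∂γ = W1 μ₀ μ₁)
    (σ : ℝ → Measure (EuclideanSpace ℝ (Fin N)))
    (hσ : ∀ t : ℝ, σ t = γ.map (fun p => (1 - t) • p.1 + t • p.2)) :
    ∀ t₁ t₂ t₃ : ℝ, 0 ≤ t₁ → t₁ ≤ t₂ → t₂ ≤ t₃ → t₃ ≤ 1 →
      W1 (σ t₁) (σ t₂) + W1 (σ t₂) (σ t₃) = W1 (σ t₁) (σ t₃) := by
  have hprob := Coupling.isProbabilityMeasure hγ
  have hm (t : ℝ) : Measurable fun p : EuclideanSpace ℝ (Fin N) × EuclideanSpace ℝ (Fin N) =>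
      (1 - t) • p.1 + t • p.2 := by fun_prop
  have hσp (t : ℝ) : IsProbabilityMeasure (σ t) := by
    rw [hσ]; exact Measure.isProbabilityMeasure_map (hm t).aemeasurable
  have hfin := Coupling.lintegral_edist_lt_top h₀ h₁ hγ
  have hσ₀ : σ 0 = μ₀ := by rw [hσ, ← hγ.1]; simp
  have hσ₁ : σ 1 = μ₁ := by rw [hσ, ← hγ.2]; simp
  set L := ∫⁻ p, edist p.1 p.2 ∂γ with hL
  have hle {s t : ℝ} (hst : s ≤ t) : W1 (σ s) (σ t) ≤ ENNReal.ofReal (t - s) * L := by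
    rw [hσ, hσ]
    refine (W1_le_lintegral_edist γ (hm s) (hm t)).trans_eq ?_
    simp_rw [edist_interpolation _ _ hst]
    exact lintegral_const_mul _ (by fun_prop)
  have heq {s t : ℝ} (hs : 0 ≤ s) (hst : s ≤ t) (ht : t ≤ 1) :
      W1 (σ s) (σ t) = ENNReal.ofReal (t - s) * L := by
    refine (hle hst).antisymm ?_
    have htri : L ≤ ENNReal.ofReal s * L + (W1 (σ s) (σ t) + ENNReal.ofReal (1 - t) * L) := by
      calc L = W1 (σ 0) (σ 1) := by rw [hσ₀, hσ₁, hopt]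
        _ ≤ W1 (σ 0) (σ s) + (W1 (σ s) (σ t) + W1 (σ t) (σ 1)) :=
          (W1_triangle _ (σ s) _).trans (by gcongr; exact W1_triangle _ _ _)
        _ ≤ _ := by
          gcongr
          · simpa using hle hs
          · exact hle ht
    have hsplit : L = ENNReal.ofReal s * L +
        (ENNReal.ofReal (t - s) * L + ENNReal.ofReal (1 - t) * L) := by
      rw [← add_mul, ← add_mul, ← ENNReal.ofReal_add (by linarith) (by linarith),
        ← ENNReal.ofReal_add hs (by linarith)]
      simp
    have hcancel {r : ℝ} : ENNReal.ofReal r * L ≠ ⊤ :=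
      ENNReal.mul_ne_top ENNReal.ofReal_ne_top hfin.ne
    have key := hsplit.symm.le.trans htri
    rwa [ENNReal.add_le_add_iff_left hcancel, ENNReal.add_le_add_iff_right hcancel] at key
  intro t₁ t₂ t₃ h0 h12 h23 h3
  rw [heq h0 h12 (h23.trans h3), heq (h0.trans h12) h23 h3, heq h0 (h12.trans h23) h3, ← add_mul,
    ← ENNReal.ofReal_add (by linarith) (by linarith)]
  congr 2
  ring
end
end
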